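/- arXiv:math/0110332 — 3 statements merged into one kernel-verified Lean document; each statement's English description precedes it below -/
import Mathlib

section
/- Let C be a chain complex of finitely generated free abelian groups with C_q = 0 for q < 0 and for q > n (some n). Then there exist a minimal chain complex M of finitely generated free abelian groups with M_q = 0 for q < 0 and q > n, chain maps f : C → M and g : M → C, and homomorphisms φ_q : C_q → C_{q+1}, such that (f, g, φ) is a contraction of C to M, i.e., f ∘ g = id_M, id_C − g ∘ f = φ∂ + ∂φ, φ ∘ g = 0, f ∘ φ = 0, and φ ∘ φ = 0. (In particular, every finite simplicial complex K, whose simplicial chain complex C_*(K) is a bounded chain complex of finitely generated free abelian groups, admits an algebraic minimal model.) -/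
/-- A chain complex of abelian groups, indexed by `ℤ`, with differentials
`d q : X (q + 1) → X q` satisfying `d ∘ d = 0`. -/
structure ChainCpx where
  X : ℤ → Type
  [grp : ∀ q, AddCommGroup (X q)]
  d : ∀ q : ℤ, X (q + 1) →+ X q
  dd : ∀ (q : ℤ) (x : X (q + 1 + 1)), d q (d (q + 1) x) = 0

attribute [instance] ChainCpx.grp

/-- A chain complex `M` (of finitely generated free abelian groups) is minimal if in each
degree its differential is either zero or has image contained in `m • M` for some integer
`m ≥ 2` (i.e. the first diagonal entry of the Smith normal form of its matrix is `≠ 1`). -/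
def ChainCpx.IsMinimal (M : ChainCpx) : Prop :=
  ∀ q : ℤ, M.d q = 0 ∨ ∃ m : ℤ, 2 ≤ m ∧ ∀ x : M.X (q + 1), ∃ y : M.X q, M.d q x = m • y

/-- The values `l (G x)` attain their gcd. -/
theorem gcd_attained {A B : Type} [AddCommGroup A] [AddCommGroup B]
    (G : A →ₗ[ℤ] B) (h : ∃ (x : A) (l : B →ₗ[ℤ] ℤ), l (G x) ≠ 0) :
    ∃ (a : ℤ) (x : A) (l : B →ₗ[ℤ] ℤ), 0 < a ∧ l (G x) = a ∧
      ∀ (y : A) (m : B →ₗ[ℤ] ℤ), a ∣ m (G y) := by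
  classical
  have hex : ∃ k : ℕ, 0 < k ∧ ∃ (x : A) (l : B →ₗ[ℤ] ℤ), l (G x) = (k : ℤ) := by
    obtain ⟨x, l, hl⟩ := h
    rcases lt_or_gt_of_ne hl with h1 | h1
    · exact ⟨(-(l (G x))).toNat, by omega, x, -l, by simp; omega⟩
    · exact ⟨(l (G x)).toNat, by omega, x, l, by simp; omega⟩
  obtain ⟨hk0, x, l, hx⟩ := Nat.find_spec hex
  have hmin := fun (k : ℕ) (hk : k < Nat.find hex) => Nat.find_min hex hk
  generalize Nat.find hex = k at *
  -- any value congruent to something nonzero mod k gives a contradiction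
  have key : ∀ (v : ℤ), (∀ c : ℤ, ∃ (y : A) (m : B →ₗ[ℤ] ℤ), m (G y) = v - c * k) →
      (k : ℤ) ∣ v := by
    intro v hv
    by_contra hnd
    obtain ⟨y, m, hm⟩ := hv (v / k)
    have e : v - v / k * k = v % k := by rw [Int.emod_def]; ring
    rw [e] at hm
    have h0 : v % k ≠ 0 := fun h => hnd (Int.dvd_of_emod_eq_zero h)
    have h1 : 0 ≤ v % (k : ℤ) := Int.emod_nonneg _ (by omega)
    have h2 : v % (k : ℤ) < k := Int.emod_lt_of_pos _ (by omega)
    exact hmin (v % (k : ℤ)).toNat (by omega) ⟨by omega, y, m, by rw [hm]; omega⟩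
  have hl : ∀ y, (k : ℤ) ∣ l (G y) := fun y =>
    key _ fun c => ⟨y - c • x, l, by simp [hx]⟩
  have hm : ∀ m : B →ₗ[ℤ] ℤ, (k : ℤ) ∣ m (G x) := fun m =>
    key _ fun c => ⟨x, m - c • l, by simp [hx]⟩
  refine ⟨k, x, l, by omega, hx, fun y m => ?_⟩
  obtain ⟨s, hs⟩ := hl y
  obtain ⟨t, ht⟩ := hm m
  have h3 : (k : ℤ) ∣ (m - t • l) (G (y - s • x)) := by
    refine key _ fun c => ?_
    refine ⟨(y - s • x) + x, (m - t • l) - (c • l), ?_⟩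
    simp [hx, hs, ht]
    ring
  have h4 : (m - t • l) (G (y - s • x)) = m (G y) - k * (s * t) := by
    simp [hx, hs, ht]
    ring
  rw [h4] at h3
  exact (dvd_sub_left (Dvd.intro _ rfl)).mp h3

/-- A maximal partial inverse of a linear map. -/
theorem exists_partial_inverse {A B : Type} [AddCommGroup A] [AddCommGroup B]
    [Module.Finite ℤ A] [Module.Free ℤ B] [Module.Finite ℤ B] (F : A →ₗ[ℤ] B) :
    ∃ p : B →ₗ[ℤ] A, (∀ b, p (F (p b)) = p b) ∧
      ((∀ x, F x - F (p (F x)) = 0) ∨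
        ∃ m : ℤ, 2 ≤ m ∧ ∀ x, ∃ y, F x - F (p (F x)) = m • y) := by
  classical
  let S : Set (Submodule ℤ A) :=
    {N | ∃ p : B →ₗ[ℤ] A, (∀ b, p (F (p b)) = p b) ∧ LinearMap.range p = N}
  have hS : S.Nonempty := ⟨_, 0, by simp, rfl⟩
  obtain ⟨N, ⟨p, hp, hN⟩, hmax⟩ :=
    (wellFounded_gt : WellFounded (fun a b : Submodule ℤ A => a > b)).has_min S hS
  refine ⟨p, hp, ?_⟩
  by_cases h0 : ∀ x, F x - F (p (F x)) = 0
  · exact Or.inl h0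
  right
  let bs := Module.Free.chooseBasis ℤ B
  let G : A →ₗ[ℤ] B := F - F ∘ₗ p ∘ₗ F
  have hG : ∀ x, G x = F x - F (p (F x)) := fun x => rfl
  have hne : ∃ (x : A) (l : B →ₗ[ℤ] ℤ), l (G x) ≠ 0 := by
    push Not at h0
    obtain ⟨x, hx⟩ := h0
    by_contra hcon
    push Not at hcon
    apply hx
    rw [← hG]
    exact bs.ext_elem fun i => by simpa using hcon x (bs.coord i)
  obtain ⟨a, x, l, ha, hax, hdiv⟩ := gcd_attained G hne
  by_cases ha1 : a = 1
  · exfalso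
    subst ha1
    let x' : A := x - p (F x)
    let l' : B →ₗ[ℤ] ℤ := l - l ∘ₗ F ∘ₗ p
    have hl' : ∀ b, l' b = l b - l (F (p b)) := fun b => rfl
    have hpx : p (F x') = 0 := by simp [x', hp]
    have hlx : l' (F x') = 1 := by
      rw [hl', hpx, ← hax, hG]
      simp [x']
    have hlp : ∀ b, l' (F (p b)) = 0 := fun b => by simp [hl', hp]
    let p' : B →ₗ[ℤ] A := p + l'.smulRight x'
    have hp' : ∀ b, p' b = p b + l' b • x' := fun b => rfl
    refine hmax (LinearMap.range p') ⟨p', fun b => ?_, rfl⟩ ?_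
    · simp [hp', hp, hpx, hlx, hlp]
    · rw [← hN]
      refine lt_of_le_of_ne ?_ ?_
      · rintro _ ⟨b, rfl⟩
        exact ⟨F (p b), by simp [hp', hp, hlp]⟩
      · intro heq
        have : x' ∈ LinearMap.range p := by
          rw [heq]
          exact ⟨F x', by simp [hp', hpx, hlx]⟩
        obtain ⟨b, hb⟩ := this
        have : x' = 0 := by rw [← hb, ← hp, hb, hpx]
        rw [this] at hlx
        simp at hlx
  · refine ⟨a, by omega, fun y => ?_⟩
    choose c hc using fun i => hdiv y (bs.coord i)
    refine ⟨∑ i, c i • bs i, ?_⟩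
    rw [← hG]
    refine bs.ext_elem fun i => ?_
    have := hc i
    simp only [Module.Basis.coord_apply] at this
    rw [this, map_smul, Finsupp.smul_apply, bs.repr_sum_self, smul_eq_mul]

/-- A projection onto the kernel. -/
theorem exists_kernel_projection {A B : Type} [AddCommGroup A] [AddCommGroup B]
    [Module.Free ℤ B] [Module.Finite ℤ B] (F : A →ₗ[ℤ] B) :
    ∃ r : A →ₗ[ℤ] A, (∀ x, F (r x) = 0) ∧ ∀ x, F x = 0 → r x = x := by
  obtain ⟨s, hs⟩ := F.rangeRestrict.exists_rightInverse_of_surjective F.range_rangeRestrict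
  refine ⟨LinearMap.id - s ∘ₗ F.rangeRestrict, fun x => ?_, fun x hx => ?_⟩
  · have h1 := congrArg Subtype.val (LinearMap.congr_fun hs (F.rangeRestrict x))
    simp at h1
    simp [h1]
  · have : F.rangeRestrict x = 0 := Subtype.ext hx
    simp [this]

theorem exists_shift {X : ℤ → Type} [∀ q, AddCommGroup (X q)]
    (h : ∀ q, X (q + 1) →+ X (q + 1)) :
    ∃ e : ∀ q, X q →+ X q, ∀ q, e (q + 1) = h q := by
  have : ∀ q, ∃ e : X q →+ X q, ∀ r, q = r + 1 → HEq e (h r) := by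
    intro q
    obtain ⟨r, rfl⟩ : ∃ r, q = r + 1 := ⟨q - 1, by ring⟩
    refine ⟨h r, fun r' hr => ?_⟩
    obtain rfl : r = r' := by omega
    rfl
  choose e he using this
  exact ⟨e, fun q => eq_of_heq (he _ q rfl)⟩

/-- Existence of the algebraic minimal model: every bounded chain complex `C` of finitely
generated free abelian groups (e.g. the simplicial chain complex of a finite simplicial
complex) admits a contraction `(f, g, φ)` onto a minimal chain complex `M` of finitely
generated free abelian groups with the same bounds, i.e. chain maps `f : C → M`,
`g : M → C` and homomorphisms `φ q : C q → C (q+1)` with `f ∘ g = id`,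
`id - g ∘ f = φ∂ + ∂φ`, `φ ∘ g = 0`, `f ∘ φ = 0` and `φ ∘ φ = 0`. -/
theorem exists_algebraic_minimal_model
    (C : ChainCpx) (hfree : ∀ q, Module.Free ℤ (C.X q))
    (hfin : ∀ q, Module.Finite ℤ (C.X q))
    (n : ℤ) (hbound : ∀ q : ℤ, (q < 0 ∨ n < q) → ∀ x : C.X q, x = 0) :
    ∃ M : ChainCpx,
      (∀ q, Module.Free ℤ (M.X q)) ∧ (∀ q, Module.Finite ℤ (M.X q)) ∧
      (∀ q : ℤ, (q < 0 ∨ n < q) → ∀ x : M.X q, x = 0) ∧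
      M.IsMinimal ∧
      ∃ (f : ∀ q : ℤ, C.X q →+ M.X q) (g : ∀ q : ℤ, M.X q →+ C.X q)
        (φ : ∀ q : ℤ, C.X q →+ C.X (q + 1)),
        (∀ (q : ℤ) (x : C.X (q + 1)), f q (C.d q x) = M.d q (f (q + 1) x)) ∧
        (∀ (q : ℤ) (y : M.X (q + 1)), g q (M.d q y) = C.d q (g (q + 1) y)) ∧
        (∀ (q : ℤ) (y : M.X q), f q (g q y) = y) ∧
        (∀ (q : ℤ) (x : C.X (q + 1)),
          x - g (q + 1) (f (q + 1) x) = φ q (C.d q x) + C.d (q + 1) (φ (q + 1) x)) ∧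
        (∀ (q : ℤ) (y : M.X q), φ q (g q y) = 0) ∧
        (∀ (q : ℤ) (x : C.X q), f (q + 1) (φ q x) = 0) ∧
        (∀ (q : ℤ) (x : C.X q), φ (q + 1) (φ q x) = 0) := by
  have h1 : ∀ q, ∃ p : C.X q →+ C.X (q + 1), (∀ b, p (C.d q (p b)) = p b) ∧
      ((∀ x, C.d q x - C.d q (p (C.d q x)) = 0) ∨
        ∃ m : ℤ, 2 ≤ m ∧ ∀ x, ∃ y, C.d q x - C.d q (p (C.d q x)) = m • y) := by
    intro q
    obtain ⟨p, hp⟩ := exists_partial_inverse (C.d q).toIntLinearMap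
    exact ⟨p.toAddMonoidHom, hp⟩
  have h2 : ∀ q, ∃ r : C.X (q + 1) →+ C.X (q + 1), (∀ x, C.d q (r x) = 0) ∧
      ∀ x, C.d q x = 0 → r x = x := by
    intro q
    obtain ⟨p, hp⟩ := exists_kernel_projection (C.d q).toIntLinearMap
    exact ⟨p.toAddMonoidHom, hp⟩
  choose p hp hpm using h1
  choose r' hr1' hr2' using h2
  obtain ⟨r, hr⟩ := exists_shift r'
  have hr1 : ∀ q x, C.d q (r (q + 1) x) = 0 := fun q x => by rw [hr]; exact hr1' q x
  have hr2 : ∀ q x, C.d q x = 0 → r (q + 1) x = x := fun q x hx => by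
    rw [hr]; exact hr2' q x hx
  have hrd : ∀ q x, r q (C.d q x) = C.d q x := by
    intro q
    obtain ⟨s, rfl⟩ : ∃ s, q = s + 1 := ⟨q - 1, by ring⟩
    exact fun x => hr2 _ _ (C.dd _ _)
  have hrr : ∀ q x, r q (r q x) = r q x := by
    intro q
    obtain ⟨s, rfl⟩ : ∃ s, q = s + 1 := ⟨q - 1, by ring⟩
    exact fun x => hr2 _ _ (hr1 _ _)
  let φ : ∀ q : ℤ, C.X q →+ C.X (q + 1) := fun q =>
    (AddMonoidHom.id _ - r (q + 1)).comp ((p q).comp (r q))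
  have hφ : ∀ q x, φ q x = p q (r q x) - r (q + 1) (p q (r q x)) := fun q x => rfl
  have hdφ : ∀ q x, C.d q (φ q x) = C.d q (p q (r q x)) := fun q x => by
    rw [hφ, map_sub, hr1, sub_zero]
  have hφφ : ∀ q x, φ (q + 1) (φ q x) = 0 := fun q x => by
    have : r (q + 1) (φ q x) = 0 := by rw [hφ, map_sub, hrr, sub_self]
    rw [hφ, this]; simp
  have hφdφ : ∀ q x, φ q (C.d q (φ q x)) = φ q x := fun q x => by
    rw [hdφ, hφ, hrd, hp, ← hφ]
  have hdφd : ∀ q x, C.d q (φ q (C.d q x)) = C.d q (p q (C.d q x)) := fun q x => by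
    rw [hdφ, hrd]
  obtain ⟨e, he⟩ := exists_shift (X := C.X) (fun q => (φ q).comp (C.d q))
  let P : ∀ q : ℤ, C.X q →+ C.X q := fun q => AddMonoidHom.id _ - e q - (C.d q).comp (φ q)
  have hP : ∀ q x, P (q + 1) x = x - φ q (C.d q x) - C.d (q + 1) (φ (q + 1) x) := by
    intro q x
    simp [P, he]
  have hPd : ∀ q x, P q (C.d q x) = C.d q x - C.d q (φ q (C.d q x)) := by
    intro q
    obtain ⟨s, rfl⟩ : ∃ s, q = s + 1 := ⟨q - 1, by ring⟩
    intro x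
    rw [hP, C.dd]; simp
  have hdP : ∀ q x, C.d q (P (q + 1) x) = C.d q x - C.d q (φ q (C.d q x)) := by
    intro q x
    rw [hP, map_sub, map_sub, C.dd]; simp
  have hPφ : ∀ q x, P (q + 1) (φ q x) = 0 := by
    intro q x
    rw [hP, hφdφ, hφφ]; simp
  have hφP : ∀ q x, φ q (P q x) = 0 := by
    intro q
    obtain ⟨s, rfl⟩ : ∃ s, q = s + 1 := ⟨q - 1, by ring⟩
    intro x
    rw [hP, map_sub, map_sub, hφφ, hφdφ]; simp
  have hPP : ∀ q x, P q (P q x) = P q x := by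
    intro q
    obtain ⟨s, rfl⟩ : ∃ s, q = s + 1 := ⟨q - 1, by ring⟩
    intro x
    rw [hP s (P (s + 1) x), hφP, hdP, map_sub, hφdφ]; simp
  have hdmem : ∀ q (x : (P (q + 1)).range), C.d q x ∈ (P q).range := by
    rintro q ⟨_, x, rfl⟩
    exact ⟨C.d q x, by rw [hPd, hdP]⟩
  let M : ChainCpx :=
    { X := fun q => (P q).range
      d := fun q => ((C.d q).comp (P (q + 1)).range.subtype).codRestrict (P q).range (hdmem q)
      dd := fun q x => Subtype.ext (C.dd q x) }
  have hMd : ∀ q (x : (P (q + 1)).range), ((M.d q x : (P q).range) : C.X q) = C.d q x :=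
    fun q x => rfl
  have hfix : ∀ q (y : (P q).range), P q y = y := by
    rintro q ⟨_, x, rfl⟩
    exact hPP q x
  refine ⟨M, fun q => ?_, fun q => ?_, fun q hq x => Subtype.ext (hbound q hq _), fun q => ?_,
    fun q => (P q).rangeRestrict, fun q => (P q).range.subtype, φ, ?_, ?_, ?_, ?_, ?_, ?_, hφφ⟩
  · exact inferInstanceAs (Module.Free ℤ (AddSubgroup.toIntSubmodule (P q).range))
  · exact inferInstanceAs (Module.Finite ℤ (AddSubgroup.toIntSubmodule (P q).range))
  · have hx : ∀ x : (P (q + 1)).range,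
        C.d q x = C.d q x - C.d q (p q (C.d q x)) := fun x => by
      rw [← hdφd, ← hdP, hfix]
    rcases hpm q with h | ⟨m, hm, h⟩
    · left
      ext x
      exact (hx x).trans (h _)
    · right
      refine ⟨m, hm, fun x => ?_⟩
      obtain ⟨y, hy⟩ := h (x : (P (q + 1)).range)
      refine ⟨(P q).rangeRestrict y, Subtype.ext ?_⟩
      have h3 : C.d q (x : (P (q + 1)).range) = m • y := (hx x).trans hy
      have h4 : P q (C.d q (x : (P (q + 1)).range)) = C.d q (x : (P (q + 1)).range) :=
        hfix q ⟨_, hdmem q x⟩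
      rw [h3, map_zsmul] at h4
      exact h3.trans h4.symm
  · intro q x
    exact Subtype.ext ((hPd q x).trans (hdP q x).symm)
  · intro q y
    rfl
  · intro q y
    exact Subtype.ext (hfix q y)
  · intro q x
    change x - P (q + 1) x = _
    rw [hP]; abel
  · rintro q ⟨_, x, rfl⟩
    exact hφP q x
  · intro q x
    exact Subtype.ext (hPφ q x)
end

section
/- Let C be a chain complex of finitely generated free abelian groups with C_q = 0 for q < 0 and q > n, and let M and M' be two minimal chain complexes of finitely generated free abelian groups each equipped with a contraction of C onto it. Then M and M' are isomorphic as chain complexes: there exist group isomorphisms θ_q : M_q → M'_q for all q commuting with the differentials. -/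
/-- `(f, g, φ)` is a contraction of the chain complex `N` to the chain complex `M`:
`f` and `g` are chain maps, `f ∘ g = id`, `id - g ∘ f = φ∂ + ∂φ`, `φ ∘ g = 0`,
`f ∘ φ = 0` and `φ ∘ φ = 0`. -/
def IsContraction (N M : ChainCpx) (f : ∀ q : ℤ, N.X q →+ M.X q)
    (g : ∀ q : ℤ, M.X q →+ N.X q) (φ : ∀ q : ℤ, N.X q →+ N.X (q + 1)) : Prop :=
  (∀ (q : ℤ) (x : N.X (q + 1)), f q (N.d q x) = M.d q (f (q + 1) x)) ∧
  (∀ (q : ℤ) (y : M.X (q + 1)), g q (M.d q y) = N.d q (g (q + 1) y)) ∧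
  (∀ (q : ℤ) (y : M.X q), f q (g q y) = y) ∧
  (∀ (q : ℤ) (x : N.X (q + 1)),
    x - g (q + 1) (f (q + 1) x) = φ q (N.d q x) + N.d (q + 1) (φ (q + 1) x)) ∧
  (∀ (q : ℤ) (y : M.X q), φ q (g q y) = 0) ∧
  (∀ (q : ℤ) (x : N.X q), f (q + 1) (φ q x) = 0) ∧
  (∀ (q : ℤ) (x : N.X q), φ (q + 1) (φ q x) = 0)

namespace AMM

/-- Homs to `ZMod c` vanishing on `B`. -/
def H {Z : Type} [AddCommGroup Z] (B : Submodule ℤ Z) (c : ℕ) : Set (Z →ₗ[ℤ] ZMod c) :=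
  {φ | ∀ b ∈ B, φ b = 0}

section
variable {Z : Type} [AddCommGroup Z] [Module.Free ℤ Z] [Module.Finite ℤ Z]

theorem card_hom (c : ℕ) [NeZero c] :
    Nat.card (Z →ₗ[ℤ] ZMod c) = c ^ Module.finrank ℤ Z := by
  have b := Module.finBasis ℤ Z
  rw [← Nat.card_congr (b.constr ℤ (M' := ZMod c)).toEquiv]
  simp [Nat.card_eq_fintype_card, ZMod.card]

theorem finite_hom (c : ℕ) [NeZero c] : Finite (Z →ₗ[ℤ] ZMod c) := by
  have b := Module.finBasis ℤ Z
  exact Finite.of_equiv _ (b.constr ℤ (M' := ZMod c)).toEquiv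

theorem ncard_H_le (B : Submodule ℤ Z) (c : ℕ) [NeZero c] :
    (H B c).ncard ≤ c ^ Module.finrank ℤ Z := by
  have := finite_hom (Z := Z) c
  rw [← card_hom, ← Set.ncard_univ]
  exact Set.ncard_le_ncard (Set.subset_univ _) (Set.toFinite _)

theorem exists_smul_of_coord (z : Z) (a : ℤ) (h : ∀ ψ : Z →ₗ[ℤ] ℤ, a ∣ ψ z) :
    ∃ w, z = a • w := by
  have b := Module.finBasis ℤ Z
  choose t ht using fun i => h (b.coord i)
  refine ⟨∑ i, t i • b i, ?_⟩
  rw [← b.sum_repr z, Finset.smul_sum]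
  refine Finset.sum_congr rfl fun i _ => ?_
  have := ht i
  rw [Module.Basis.coord_apply] at this
  rw [this, smul_smul]

theorem ncard_H_eq_iff (B : Submodule ℤ Z) (c : ℕ) [NeZero c] :
    (H B c).ncard = c ^ Module.finrank ℤ Z ↔ ∀ b ∈ B, ∃ z, b = (c : ℤ) • z := by
  have := finite_hom (Z := Z) c
  rw [← card_hom, ← Set.ncard_univ]
  constructor
  · intro h
    have h2 : H B c = Set.univ :=
      Set.eq_of_subset_of_ncard_le (Set.subset_univ _) h.ge (Set.toFinite _)
    intro b hb
    refine exists_smul_of_coord b c fun ψ => ?_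
    have h3 : (Int.castAddHom (ZMod c)).toIntLinearMap ∘ₗ ψ ∈ H B c := by rw [h2]; trivial
    have h4 := h3 b hb
    simpa [ZMod.intCast_zmod_eq_zero_iff_dvd] using h4
  · intro h
    congr 1
    ext φ
    simp only [H, Set.mem_setOf_eq, Set.mem_univ, iff_true]
    intro b hb
    obtain ⟨z, rfl⟩ := h b hb
    simp

theorem split_exists (B : Submodule ℤ Z) (hr : 0 < Module.finrank ℤ Z) :
    ∃ (a : ℤ) (χ : Z →ₗ[ℤ] ℤ) (e : Z), χ e = 1 ∧ a • e ∈ B ∧ ∀ b ∈ B, ∃ z, b = a • z := by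
  obtain ⟨I, ⟨χ, rfl⟩, hmax⟩ := set_has_maximal_iff_noetherian.mpr
    (inferInstance : IsNoetherian ℤ ℤ) (Set.range fun χ : Z →ₗ[ℤ] ℤ => B.map χ) ⟨_, 0, rfl⟩
  replace hmax : ∀ ψ : Z →ₗ[ℤ] ℤ, B.map χ ≤ B.map ψ → B.map ψ ≤ B.map χ := by
    intro ψ h
    by_contra h2
    exact hmax _ ⟨ψ, rfl⟩ (lt_of_le_not_ge h h2)
  obtain ⟨a, ha⟩ := (inferInstance : (B.map χ).IsPrincipal)
  have hay : a ∈ B.map χ := by rw [ha]; exact Submodule.mem_span_singleton_self a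
  obtain ⟨y, hyB, hy⟩ := hay
  have key : ∀ ψ : Z →ₗ[ℤ] ℤ, ∀ y' ∈ B, ψ y' ∣ a → ∀ b ∈ B, a ∣ ψ b := by
    intro ψ y' hy' hd b hb
    have h1 : B.map χ ≤ B.map ψ := by
      rw [ha, Submodule.span_singleton_le_iff_mem]
      obtain ⟨k, hk⟩ := hd
      exact ⟨k • y', B.smul_mem _ hy', by rw [map_smul, hk, smul_eq_mul, mul_comm]⟩
    have h2 := hmax ψ h1 ⟨b, hb, rfl⟩
    rw [ha, Submodule.mem_span_singleton] at h2
    obtain ⟨k, hk⟩ := h2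
    exact ⟨k, by rw [← hk, smul_eq_mul, mul_comm]⟩
  have hχ : ∀ b ∈ B, a ∣ χ b := key χ y hyB (by rw [hy])
  by_cases ha0 : a = 0
  · subst ha0
    let b := Module.finBasis ℤ Z
    refine ⟨0, b.coord ⟨0, hr⟩, b ⟨0, hr⟩, by simp, by simp, ?_⟩
    intro v hv
    exact exists_smul_of_coord v 0 fun ψ => key ψ y hyB (dvd_zero _) v hv
  · have h1 : ∀ ψ : Z →ₗ[ℤ] ℤ, a ∣ ψ y := by
      intro ψ
      have hg := Int.gcd_eq_gcd_ab a (ψ y)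
      have := key (Int.gcdA a (ψ y) • χ + Int.gcdB a (ψ y) • ψ) y hyB (by
        have : (Int.gcdA a (ψ y) • χ + Int.gcdB a (ψ y) • ψ) y = (Int.gcd a (ψ y) : ℤ) := by
          rw [hg]; simp [hy]; ring
        rw [this]; exact Int.gcd_dvd_left ..) y hyB
      have h3 : (Int.gcdA a (ψ y) • χ + Int.gcdB a (ψ y) • ψ) y = (Int.gcd a (ψ y) : ℤ) := by
          rw [hg]; simp [hy]; ring
      rw [h3] at this
      exact this.trans (Int.gcd_dvd_right ..)
    obtain ⟨e, he⟩ := exists_smul_of_coord y a h1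
    have hχe : χ e = 1 := by
      have : a * χ e = a * 1 := by rw [← smul_eq_mul, ← map_smul, ← he, hy, mul_one]
      exact mul_left_cancel₀ ha0 this
    refine ⟨a, χ, e, hχe, he ▸ hyB, fun b hb => exists_smul_of_coord b a fun ψ => ?_⟩
    have h2 := key (ψ - ψ e • χ + χ) y hyB (by
      have : (ψ - ψ e • χ + χ) y = a := by
        have : ψ y = a * ψ e := by rw [he, map_smul, smul_eq_mul]
        simp [hy, this]; ring
      rw [this]) b hb
    have h3 : ψ b = (ψ - ψ e • χ + χ) b + (ψ e - 1) * χ b := by simp; ring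
    rw [h3]
    exact dvd_add h2 ((hχ b hb).mul_left _)

end

section split
variable {Z : Type} [AddCommGroup Z]

/-- Splitting off `e`. -/
def splitEquiv (χ : Z →ₗ[ℤ] ℤ) (e : Z) (he : χ e = 1) : Z ≃ₗ[ℤ] ℤ × LinearMap.ker χ where
  toFun z := (χ z, ⟨z - χ z • e, by simp [he]⟩)
  map_add' x y := by
    ext
    · simp
    · simp [add_smul]; abel
  map_smul' k x := by
    ext
    · simp
    · simp [smul_sub, mul_smul]
  invFun p := p.1 • e + p.2
  left_inv z := by simp
  right_inv p := by
    have := p.2.2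
    rw [LinearMap.mem_ker] at this
    ext <;> simp [he]

/-- Counting splits. -/
def HEquiv (B : Submodule ℤ Z) (χ : Z →ₗ[ℤ] ℤ) (e : Z) (he : χ e = 1) (a : ℤ)
    (haB : a • e ∈ B) (hB : ∀ b ∈ B, a ∣ χ b) (c : ℕ) :
    H B c ≃ {t : ZMod c // a • t = 0} × H (B.comap (LinearMap.ker χ).subtype) c where
  toFun φ := (⟨φ.1 e, by rw [← map_smul]; exact φ.2 _ haB⟩,
    ⟨φ.1 ∘ₗ (LinearMap.ker χ).subtype, fun b hb => φ.2 _ hb⟩)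
  invFun p := ⟨(LinearMap.toSpanSingleton ℤ (ZMod c) p.1.1).coprod p.2.1 ∘ₗ
      (splitEquiv χ e he).toLinearMap, by
    intro b hb
    obtain ⟨k, hk⟩ := hB b hb
    have h1 : (χ b) • p.1.1 = 0 := by rw [hk, mul_comm, mul_smul, p.1.2, smul_zero]
    have h2 : p.2.1 ⟨b - χ b • e, by simp [he]⟩ = 0 := by
      apply p.2.2
      change b - χ b • e ∈ B
      rw [hk, mul_comm, mul_smul]
      exact B.sub_mem hb (B.smul_mem _ haB)
    change (χ b) • p.1.1 + p.2.1 ⟨b - χ b • e, _⟩ = 0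
    rw [h1, h2, add_zero]⟩
  left_inv φ := by
    apply Subtype.ext
    ext z
    change χ z • φ.1 e + φ.1 (z - χ z • e) = φ.1 z
    rw [map_sub, map_smul]; abel
  right_inv p := by
    obtain ⟨⟨t, ht⟩, ⟨ψ, hψ⟩⟩ := p
    refine Prod.ext (Subtype.ext ?_) (Subtype.ext (LinearMap.ext fun k => ?_))
    · change χ e • t + ψ ⟨e - χ e • e, _⟩ = t
      have : (⟨e - χ e • e, by simp [he]⟩ : LinearMap.ker χ) = 0 := by
        apply Subtype.ext; simp [he]
      rw [this, he]; simp
    · change χ k.1 • t + ψ ⟨k.1 - χ k.1 • e, _⟩ = ψ k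
      have hk : χ k.1 = 0 := k.2
      have : (⟨k.1 - χ k.1 • e, by simp [he]⟩ : LinearMap.ker χ) = k := by
        apply Subtype.ext; simp [hk]
      rw [this, hk]; simp

end split

theorem dvd_of_nat (a a' : ℤ) (h : ∀ c : ℕ, c ≠ 0 → (c : ℤ) ∣ a → (c : ℤ) ∣ a') : a ∣ a' := by
  by_cases ha : a = 0
  · subst ha
    have h1 := h (a'.natAbs + 1) (by omega) (dvd_zero _)
    have h2 : a' = 0 := by
      apply Int.eq_zero_of_abs_lt_dvd h1
      push_cast; omega
    rw [h2]
  · have := h a.natAbs (by omega) (Int.natAbs_dvd.mpr dvd_rfl)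
    exact Int.natAbs_dvd.mp this

theorem pair_iso (r : ℕ) : ∀ (Z Z' : Type) [AddCommGroup Z] [AddCommGroup Z']
    [Module.Free ℤ Z] [Module.Finite ℤ Z] [Module.Free ℤ Z'] [Module.Finite ℤ Z']
    (B : Submodule ℤ Z) (B' : Submodule ℤ Z'),
    Module.finrank ℤ Z = r → Module.finrank ℤ Z' = r →
    (∀ c : ℕ, c ≠ 0 → (H B c).ncard = (H B' c).ncard) →
    ∃ θ : Z ≃ₗ[ℤ] Z', ∀ z, θ z ∈ B' ↔ z ∈ B := by
  induction r with
  | zero =>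
    intro Z Z' _ _ _ _ _ _ B B' h h' _
    have := Module.finrank_zero_iff.mp h
    have := Module.finrank_zero_iff.mp h'
    refine ⟨LinearEquiv.ofFinrankEq _ _ (h.trans h'.symm), fun z => ?_⟩
    rw [Subsingleton.elim z 0]; simp
  | succ r ih =>
    intro Z Z' _ _ _ _ _ _ B B' h h' hc
    obtain ⟨a, χ, e, he, haB, hB⟩ := split_exists B (by omega)
    obtain ⟨a', χ', e', he', haB', hB'⟩ := split_exists B' (by omega)
    have hd : ∀ c : ℕ, c ≠ 0 → ((c : ℤ) ∣ a ↔ (c : ℤ) ∣ a') := by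
      intro c hc0
      have : NeZero c := ⟨hc0⟩
      have e1 := ncard_H_eq_iff B c
      have e2 := ncard_H_eq_iff B' c
      rw [h, hc c hc0] at e1
      rw [h', e1] at e2
      have f1 : (∀ b ∈ B, ∃ z, b = (c : ℤ) • z) ↔ (c : ℤ) ∣ a := by
        constructor
        · intro hh
          obtain ⟨z, hz⟩ := hh _ haB
          refine ⟨χ z, ?_⟩
          have := congrArg χ hz
          simpa [he] using this
        · rintro ⟨k, rfl⟩ b hb
          obtain ⟨z, hz⟩ := hB b hb
          exact ⟨k • z, by rw [hz, mul_smul]⟩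
      have f2 : (∀ b ∈ B', ∃ z, b = (c : ℤ) • z) ↔ (c : ℤ) ∣ a' := by
        constructor
        · intro hh
          obtain ⟨z, hz⟩ := hh _ haB'
          refine ⟨χ' z, ?_⟩
          have := congrArg χ' hz
          simpa [he'] using this
        · rintro ⟨k, rfl⟩ b hb
          obtain ⟨z, hz⟩ := hB' b hb
          exact ⟨k • z, by rw [hz, mul_smul]⟩
      rw [← f1, ← f2, e2]
    have d1 : a ∣ a' := dvd_of_nat _ _ fun c h0 => (hd c h0).1
    have d2 : a' ∣ a := dvd_of_nat _ _ fun c h0 => (hd c h0).2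
    have hBχ : ∀ b ∈ B, a ∣ χ b := by
      intro b hb
      obtain ⟨z, rfl⟩ := hB b hb
      exact ⟨χ z, by simp⟩
    have hBχ' : ∀ b ∈ B', a' ∣ χ' b := by
      intro b hb
      obtain ⟨z, rfl⟩ := hB' b hb
      exact ⟨χ' z, by simp⟩
    have r1 : Module.finrank ℤ (LinearMap.ker χ) = r := by
      have := (splitEquiv χ e he).finrank_eq
      rw [Module.finrank_prod, h] at this
      simp at this; omega
    have r2 : Module.finrank ℤ (LinearMap.ker χ') = r := by
      have := (splitEquiv χ' e' he').finrank_eq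
      rw [Module.finrank_prod, h'] at this
      simp at this; omega
    obtain ⟨θ, hθ⟩ := ih (LinearMap.ker χ) (LinearMap.ker χ')
      (B.comap (LinearMap.ker χ).subtype) (B'.comap (LinearMap.ker χ').subtype) r1 r2 (by
        intro c hc0
        have : NeZero c := ⟨hc0⟩
        have g1 := Nat.card_congr (HEquiv B χ e he a haB hBχ c)
        have g2 := Nat.card_congr (HEquiv B' χ' e' he' a' haB' hBχ' c)
        rw [Nat.card_prod] at g1 g2
        have g3 : Nat.card {t : ZMod c // a • t = 0} = Nat.card {t : ZMod c // a' • t = 0} := by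
          apply Nat.card_congr
          refine Equiv.subtypeEquivRight fun t => ⟨fun ht => ?_, fun ht => ?_⟩
          · obtain ⟨k, rfl⟩ := d1
            rw [mul_comm, mul_smul, ht, smul_zero]
          · obtain ⟨k, rfl⟩ := d2
            rw [mul_comm, mul_smul, ht, smul_zero]
        have g4 : 0 < Nat.card {t : ZMod c // a' • t = 0} := by
          have : Nonempty {t : ZMod c // a' • t = 0} := ⟨⟨0, smul_zero _⟩⟩
          exact Nat.card_pos
        have g5 : Nat.card (H B c) = Nat.card (H B' c) := hc c hc0
        rw [g1, g2, g3] at g5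
        exact Nat.eq_of_mul_eq_mul_left g4 g5)
    have mem : ∀ z, z ∈ B ↔ a ∣ χ z ∧ z - χ z • e ∈ B := by
      intro z
      have : a ∣ χ z → χ z • e ∈ B := by
        rintro ⟨k, hk⟩
        rw [hk, mul_comm, mul_smul]; exact B.smul_mem _ haB
      constructor
      · intro hz
        exact ⟨hBχ z hz, B.sub_mem hz (this (hBχ z hz))⟩
      · rintro ⟨h1, h2⟩
        simpa using B.add_mem h2 (this h1)
    have mem' : ∀ z, z ∈ B' ↔ a' ∣ χ' z ∧ z - χ' z • e' ∈ B' := by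
      intro z
      have : a' ∣ χ' z → χ' z • e' ∈ B' := by
        rintro ⟨k, hk⟩
        rw [hk, mul_comm, mul_smul]; exact B'.smul_mem _ haB'
      constructor
      · intro hz
        exact ⟨hBχ' z hz, B'.sub_mem hz (this (hBχ' z hz))⟩
      · rintro ⟨h1, h2⟩
        simpa using B'.add_mem h2 (this h1)
    refine ⟨(splitEquiv χ e he).trans
      (((LinearEquiv.refl ℤ ℤ).prodCongr θ).trans (splitEquiv χ' e' he').symm), fun z => ?_⟩
    have hz : ((splitEquiv χ e he).trans
      (((LinearEquiv.refl ℤ ℤ).prodCongr θ).trans (splitEquiv χ' e' he').symm)) z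
      = χ z • e' + (θ ⟨z - χ z • e, by simp [he]⟩ : Z') := rfl
    rw [hz, mem z, mem']
    set w := θ ⟨z - χ z • e, by simp [he]⟩ with hw
    have hw0 : χ' w.1 = 0 := w.2
    have hx : χ' (χ z • e' + (w : Z')) = χ z := by simp [he', hw0]
    rw [hx, add_sub_cancel_left]
    have := hθ ⟨z - χ z • e, by simp [he]⟩
    rw [← hw] at this
    exact and_congr ⟨d1.trans, d2.trans⟩ this

/-- Extension of isos on kernel and range. -/
theorem extend_iso {X Y X' Y' : Type} [AddCommGroup X] [AddCommGroup Y] [AddCommGroup X']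
    [AddCommGroup Y'] [Module.Free ℤ Y] [Module.Finite ℤ Y] [Module.Free ℤ Y']
    [Module.Finite ℤ Y'] (D : X →ₗ[ℤ] Y) (D' : X' →ₗ[ℤ] Y')
    (α : LinearMap.ker D ≃ₗ[ℤ] LinearMap.ker D')
    (β : LinearMap.range D ≃ₗ[ℤ] LinearMap.range D') :
    ∃ θ : X ≃ₗ[ℤ] X', (∀ x : LinearMap.ker D, θ x = α x) ∧
      ∀ x, D' (θ x) = β (D.rangeRestrict x) := by
  obtain ⟨s, hs⟩ := Module.projective_lifting_property D.rangeRestrict LinearMap.id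
    D.surjective_rangeRestrict
  obtain ⟨s', hs'⟩ := Module.projective_lifting_property D'.rangeRestrict LinearMap.id
    D'.surjective_rangeRestrict
  have hs1 : ∀ y, D.rangeRestrict (s y) = y := fun y => LinearMap.congr_fun hs y
  have hs1' : ∀ y, D'.rangeRestrict (s' y) = y := fun y => LinearMap.congr_fun hs' y
  have hs2 : ∀ y, D (s y) = y := fun y => congrArg Subtype.val (hs1 y)
  have hs2' : ∀ y, D' (s' y) = y := fun y => congrArg Subtype.val (hs1' y)
  let P : X →ₗ[ℤ] LinearMap.ker D := (LinearMap.id - s ∘ₗ D.rangeRestrict).codRestrict _ (by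
    intro x; simp [hs2])
  let P' : X' →ₗ[ℤ] LinearMap.ker D' := (LinearMap.id - s' ∘ₗ D'.rangeRestrict).codRestrict _ (by
    intro x; simp [hs2'])
  have hP : ∀ x, (P x : X) = x - s (D.rangeRestrict x) := fun x => rfl
  have hP' : ∀ x, (P' x : X') = x - s' (D'.rangeRestrict x) := fun x => rfl
  have k0 : ∀ x : LinearMap.ker D, D.rangeRestrict (x : X) = 0 := fun x => Subtype.ext x.2
  have k0' : ∀ x : LinearMap.ker D', D'.rangeRestrict (x : X') = 0 := fun x => Subtype.ext x.2
  let F : X →ₗ[ℤ] X' := (LinearMap.ker D').subtype ∘ₗ α.toLinearMap ∘ₗ P +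
    s' ∘ₗ β.toLinearMap ∘ₗ D.rangeRestrict
  let G : X' →ₗ[ℤ] X := (LinearMap.ker D).subtype ∘ₗ α.symm.toLinearMap ∘ₗ P' +
    s ∘ₗ β.symm.toLinearMap ∘ₗ D'.rangeRestrict
  have hF : ∀ x, F x = (α (P x) : X') + s' (β (D.rangeRestrict x)) := fun x => rfl
  have hG : ∀ x, G x = (α.symm (P' x) : X) + s (β.symm (D'.rangeRestrict x)) := fun x => rfl
  have hDF : ∀ x, D'.rangeRestrict (F x) = β (D.rangeRestrict x) := by
    intro x; rw [hF, map_add, k0', hs1', zero_add]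
  have hDG : ∀ x, D.rangeRestrict (G x) = β.symm (D'.rangeRestrict x) := by
    intro x; rw [hG, map_add, k0, hs1, zero_add]
  have hPF : ∀ x, P' (F x) = α (P x) := by
    intro x; apply Subtype.ext; rw [hP', hDF, hF]; simp
  have hPG : ∀ x, P (G x) = α.symm (P' x) := by
    intro x; apply Subtype.ext; rw [hP, hDG, hG]; simp
  refine ⟨LinearEquiv.ofLinear F G ?_ ?_, ?_, ?_⟩
  · ext x
    change F (G x) = x
    rw [hF, hPG, hDG]; simp [hP']
  · ext x
    change G (F x) = x
    rw [hG, hPF, hDF]; simp [hP]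
  · intro x
    change F x = α x
    have : P x = x := Subtype.ext (by rw [hP, k0]; simp)
    rw [hF, this, k0]; simp
  · intro x
    exact congrArg Subtype.val (hDF x)

/-- Cycles. -/
def Cyc (M : ChainCpx) (q : ℤ) : Submodule ℤ (M.X q) where
  carrier := {x | ∀ (p : ℤ) (h : q = p + 1), M.d p (h ▸ x) = 0}
  zero_mem' := by rintro p rfl; simp
  add_mem' := by
    intro x y hx hy p h
    have h1 := hx p h
    have h2 := hy p h
    subst h
    simp only at h1 h2 ⊢
    rw [map_add, h1, h2, add_zero]
  smul_mem' := by
    intro k x hx p h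
    have h1 := hx p h
    subst h
    simp only at h1 ⊢
    rw [map_zsmul, h1, smul_zero]

theorem mem_Cyc (M : ChainCpx) (p : ℤ) (x : M.X (p + 1)) : x ∈ Cyc M (p + 1) ↔ M.d p x = 0 := by
  constructor
  · intro h; exact h p rfl
  · intro h p' h'
    obtain rfl : p = p' := by omega
    exact h

theorem Cyc_eq (M : ChainCpx) (p : ℤ) :
    Cyc M (p + 1) = LinearMap.ker (M.d p).toIntLinearMap := by
  ext x; rw [mem_Cyc]; rfl

theorem d_mem (M : ChainCpx) (q : ℤ) (x : M.X (q + 1)) : M.d q x ∈ Cyc M q := by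
  obtain ⟨p, rfl⟩ : ∃ p, q = p + 1 := ⟨q - 1, by omega⟩
  rw [mem_Cyc]; exact M.dd p x

/-- Boundaries inside cycles. -/
def Bd (M : ChainCpx) (q : ℤ) : Submodule ℤ (Cyc M q) :=
  (LinearMap.range (M.d q).toIntLinearMap).comap (Cyc M q).subtype

theorem mem_Bd (M : ChainCpx) (q : ℤ) (x : Cyc M q) : x ∈ Bd M q ↔ ∃ y, M.d q y = x := Iff.rfl

theorem min_Bd (M : ChainCpx) [∀ q, Module.Free ℤ (M.X q)] (h : M.IsMinimal) (q : ℤ) :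
    ∃ m : ℕ, m ≠ 0 ∧ 2 ≤ m ∧ ∀ b ∈ Bd M q, ∃ z, b = (m : ℤ) • z := by
  rcases h q with h | ⟨m, hm, h⟩
  · refine ⟨2, by norm_num, le_rfl, ?_⟩
    rintro b ⟨y, hy⟩
    refine ⟨0, Subtype.ext ?_⟩
    change M.d q y = b at hy
    rw [← hy, h]; simp
  · lift m to ℕ using by omega
    refine ⟨m, by omega, by omega, ?_⟩
    rintro b ⟨y, hy⟩
    change M.d q y = b at hy
    obtain ⟨w, hw⟩ := h y
    have hwc : w ∈ Cyc M q := by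
      have hb := b.2
      rw [← hy, hw] at hb
      clear hw hy
      obtain ⟨p, rfl⟩ : ∃ p, q = p + 1 := ⟨q - 1, by omega⟩
      rw [mem_Cyc] at hb ⊢
      rw [map_zsmul] at hb
      exact (smul_eq_zero.mp hb).resolve_left (by omega)
    exact ⟨⟨w, hwc⟩, Subtype.ext (by rw [← hy, hw]; rfl)⟩

/-- One-sided comparison. -/
theorem compare (C M M' : ChainCpx) (f g φ f' g' φ') (hM : IsContraction C M f g φ)
    (hM' : IsContraction C M' f' g' φ') (q : ℤ) (x : M.X q) (hx : x ∈ Cyc M q) :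
    ∃ y, M.d q y = f q (g' q (f' q (g q x))) - x := by
  obtain ⟨p, rfl⟩ : ∃ p, q = p + 1 := ⟨q - 1, by omega⟩
  rw [mem_Cyc] at hx
  obtain ⟨a1, a2, a3, -, -, -, -⟩ := hM
  obtain ⟨-, -, -, b4, -, -, -⟩ := hM'
  have h := b4 p (g (p + 1) x)
  rw [← a2, hx, map_zero, map_zero, zero_add] at h
  have h2 := congrArg (f (p + 1)) h
  rw [map_sub, a3, a1] at h2
  exact ⟨- f _ (φ' (p + 1) (g (p + 1) x)), by rw [map_neg, ← h2]; abel⟩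

/-- A chain map on cycles. -/
def cycMap (M M' : ChainCpx) (h : ∀ q : ℤ, M.X q →+ M'.X q)
    (hh : ∀ (q : ℤ) (x : M.X (q + 1)), h q (M.d q x) = M'.d q (h (q + 1) x)) (q : ℤ) :
    Cyc M q →ₗ[ℤ] Cyc M' q :=
  ((h q).toIntLinearMap ∘ₗ (Cyc M q).subtype).codRestrict _ (by
    obtain ⟨p, rfl⟩ : ∃ p, q = p + 1 := ⟨q - 1, by omega⟩
    rintro ⟨x, hx⟩
    rw [mem_Cyc] at hx
    change h (p + 1) x ∈ Cyc M' (p + 1)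
    rw [mem_Cyc, ← hh, hx, map_zero])

/-- Transport of `H`. -/
def HTransport {Z Z' : Type} [AddCommGroup Z] [AddCommGroup Z'] (B : Submodule ℤ Z)
    (B' : Submodule ℤ Z') (h : Z →ₗ[ℤ] Z') (h' : Z' →ₗ[ℤ] Z)
    (hB : ∀ b ∈ B, h b ∈ B') (hB' : ∀ b ∈ B', h' b ∈ B)
    (e : ∀ z, h' (h z) - z ∈ B) (e' : ∀ z, h (h' z) - z ∈ B') (c : ℕ) : H B c ≃ H B' c where
  toFun φ := ⟨φ.1 ∘ₗ h', fun b hb => φ.2 _ (hB' b hb)⟩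
  invFun φ := ⟨φ.1 ∘ₗ h, fun b hb => φ.2 _ (hB b hb)⟩
  left_inv φ := by
    apply Subtype.ext; ext z
    have := φ.2 _ (e z)
    rw [map_sub, sub_eq_zero] at this
    exact this
  right_inv φ := by
    apply Subtype.ext; ext z
    have := φ.2 _ (e' z)
    rw [map_sub, sub_eq_zero] at this
    exact this

theorem ncard_eq (C M M' : ChainCpx) (f g φ f' g' φ') (hM : IsContraction C M f g φ)
    (hM' : IsContraction C M' f' g' φ') (q : ℤ) (c : ℕ) :
    (H (Bd M q) c).ncard = (H (Bd M' q) c).ncard := by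
  have c1 : ∀ (q : ℤ) (x : M.X (q + 1)), ((f' q).comp (g q)) (M.d q x)
      = M'.d q (((f' (q + 1)).comp (g (q + 1))) x) := by
    intro q x; simp [hM.2.1, hM'.1]
  have c2 : ∀ (q : ℤ) (x : M'.X (q + 1)), ((f q).comp (g' q)) (M'.d q x)
      = M.d q (((f (q + 1)).comp (g' (q + 1))) x) := by
    intro q x; simp [hM'.2.1, hM.1]
  refine Nat.card_congr (HTransport _ _ (cycMap M M' _ c1 q) (cycMap M' M _ c2 q) ?_ ?_ ?_ ?_ c)
  · rintro b ⟨y, hy⟩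
    exact ⟨_, (c1 q y).symm.trans (congrArg ((f' q).comp (g q)) hy)⟩
  · rintro b ⟨y, hy⟩
    exact ⟨_, (c2 q y).symm.trans (congrArg ((f q).comp (g' q)) hy)⟩
  · intro z
    exact compare C M M' f g φ f' g' φ' hM hM' q z z.2
  · intro z
    exact compare C M' M f' g' φ' f g φ hM' hM q z z.2

theorem rank_le (M M' : ChainCpx) [∀ q, Module.Free ℤ (M.X q)] [∀ q, Module.Finite ℤ (M.X q)]
    [∀ q, Module.Free ℤ (M'.X q)] [∀ q, Module.Finite ℤ (M'.X q)] (h : M.IsMinimal) (q : ℤ)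
    (hc : ∀ c, (H (Bd M q) c).ncard = (H (Bd M' q) c).ncard) :
    Module.finrank ℤ (Cyc M q) ≤ Module.finrank ℤ (Cyc M' q) := by
  obtain ⟨m, hm0, hm2, hm⟩ := min_Bd M h q
  have : NeZero m := ⟨hm0⟩
  rw [← ncard_H_eq_iff, hc] at hm
  have := ncard_H_le (Bd M' q) m
  rw [hm] at this
  exact (Nat.pow_le_pow_iff_right (by omega)).mp this

/-- The induced iso of boundaries. -/
theorem range_iso (M M' : ChainCpx) (q : ℤ) (θ : Cyc M q ≃ₗ[ℤ] Cyc M' q)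
    (hθ : ∀ z, θ z ∈ Bd M' q ↔ z ∈ Bd M q) :
    ∃ β : LinearMap.range (M.d q).toIntLinearMap ≃ₗ[ℤ] LinearMap.range (M'.d q).toIntLinearMap,
      ∀ x : M.X (q + 1), (β ((M.d q).toIntLinearMap.rangeRestrict x) : M'.X q)
        = θ ⟨M.d q x, d_mem M q x⟩ := by
  have hr : ∀ (N : ChainCpx), ∀ x ∈ LinearMap.range (N.d q).toIntLinearMap, x ∈ Cyc N q := by
    rintro N _ ⟨y, rfl⟩; exact d_mem N q y
  let F := ((Cyc M' q).subtype ∘ₗ θ.toLinearMap ∘ₗ Submodule.inclusion (hr M)).codRestrict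
    (LinearMap.range (M'.d q).toIntLinearMap) (fun x => (hθ ⟨x.1, hr M x.1 x.2⟩).2 x.2)
  let G := ((Cyc M q).subtype ∘ₗ θ.symm.toLinearMap ∘ₗ Submodule.inclusion (hr M')).codRestrict
    (LinearMap.range (M.d q).toIntLinearMap) (fun x => (hθ (θ.symm ⟨x.1, hr M' x.1 x.2⟩)).1 (by
      rw [LinearEquiv.apply_symm_apply]; exact x.2))
  refine ⟨LinearEquiv.ofLinear F G ?_ ?_, fun x => rfl⟩
  · refine LinearMap.ext fun x => Subtype.ext ?_
    change (θ (θ.symm ⟨x.1, hr M' x.1 x.2⟩) : M'.X q) = x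
    rw [LinearEquiv.apply_symm_apply]
  · refine LinearMap.ext fun x => Subtype.ext ?_
    change (θ.symm (θ ⟨x.1, hr M x.1 x.2⟩) : M.X q) = x
    rw [LinearEquiv.symm_apply_apply]

end AMM

/-- Uniqueness of the algebraic minimal model: if a bounded chain complex `C` of finitely
generated free abelian groups admits contractions onto two minimal chain complexes `M` and
`M'` of finitely generated free abelian groups, then `M` and `M'` are isomorphic as chain
complexes: there are group isomorphisms `θ q : M q ≃ M' q` commuting with the
differentials. -/
theorem algebraic_minimal_model_unique
    (C M M' : ChainCpx)
    (hfree : ∀ q, Module.Free ℤ (C.X q)) (hfin : ∀ q, Module.Finite ℤ (C.X q))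
    (n : ℤ) (hbound : ∀ q : ℤ, (q < 0 ∨ n < q) → ∀ x : C.X q, x = 0)
    (hfreeM : ∀ q, Module.Free ℤ (M.X q)) (hfinM : ∀ q, Module.Finite ℤ (M.X q))
    (hfreeM' : ∀ q, Module.Free ℤ (M'.X q)) (hfinM' : ∀ q, Module.Finite ℤ (M'.X q))
    (hminM : M.IsMinimal) (hminM' : M'.IsMinimal)
    (hM : ∃ f g φ, IsContraction C M f g φ)
    (hM' : ∃ f g φ, IsContraction C M' f g φ) :
    ∃ θ : ∀ q : ℤ, M.X q ≃+ M'.X q,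
      ∀ (q : ℤ) (x : M.X (q + 1)), θ q (M.d q x) = M'.d q (θ (q + 1) x) := by
  obtain ⟨f, g, φ, hM⟩ := hM
  obtain ⟨f', g', φ', hM'⟩ := hM'
  have hc := AMM.ncard_eq C M M' f g φ f' g' φ' hM hM'
  have hpair : ∀ q, ∃ θ : AMM.Cyc M q ≃ₗ[ℤ] AMM.Cyc M' q,
      ∀ z, θ z ∈ AMM.Bd M' q ↔ z ∈ AMM.Bd M q := fun q =>
    AMM.pair_iso _ _ _ _ _ rfl
      (le_antisymm (AMM.rank_le M' M hminM' q fun c => (hc q c).symm)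
        (AMM.rank_le M M' hminM q (hc q))) fun c _ => hc q c
  choose α hα using hpair
  have hext : ∀ q, ∃ θ : M.X q ≃ₗ[ℤ] M'.X q, (∀ x : AMM.Cyc M q, θ x = α q x) ∧
      ∀ (p : ℤ) (h : q = p + 1) (x : M.X q),
        M'.d p (h ▸ θ x) = α p ⟨M.d p (h ▸ x), AMM.d_mem M p _⟩ := by
    intro q
    obtain ⟨p, rfl⟩ : ∃ p, q = p + 1 := ⟨q - 1, by omega⟩
    obtain ⟨β, hβ⟩ := AMM.range_iso M M' p (α p) (hα p)
    obtain ⟨θ, h1, h2⟩ := AMM.extend_iso (M.d p).toIntLinearMap (M'.d p).toIntLinearMap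
      ((LinearEquiv.ofEq _ _ (AMM.Cyc_eq M p).symm).trans
        ((α (p + 1)).trans (LinearEquiv.ofEq _ _ (AMM.Cyc_eq M' p)))) β
    refine ⟨θ, fun x => ?_, ?_⟩
    · exact h1 ⟨x.1, by rw [← AMM.Cyc_eq]; exact x.2⟩
    · intro p' h' x
      obtain rfl : p = p' := by omega
      exact (h2 x).trans (hβ x)
  choose θ h1 h2 using hext
  refine ⟨fun q => (θ q).toAddEquiv, fun q x => ?_⟩
  exact (h1 q ⟨M.d q x, AMM.d_mem M q x⟩).trans (h2 (q + 1) q rfl x).symm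
end

section
/- Let C be a chain complex of finitely generated free abelian groups with C_q = 0 for q < 0 and q > n, and suppose that every homology group H_q(C) = ker d_q / im d_{q+1} is a free abelian group. Let H denote the chain complex whose q-th term is H_q(C) and whose differential is zero. Then there exists a contraction (f, g, φ) of C to H: chain maps f : C → H and g : H → C and homomorphisms φ_q : C_q → C_{q+1} satisfying f ∘ g = id_H, id_C − g ∘ f = φ∂ + ∂φ, φ ∘ g = 0, f ∘ φ = 0, and φ ∘ φ = 0. -/
theorem aux_section {A P : Type} [AddCommGroup A] [AddCommGroup P] [Module.Free ℤ P]
    (p : A →+ P) (hp : Function.Surjective p) : ∃ s : P →+ A, ∀ y, p (s y) = y := by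
  obtain ⟨s, hs⟩ := Module.projective_lifting_property p.toIntLinearMap LinearMap.id hp
  exact ⟨s.toAddMonoidHom, fun y => LinearMap.congr_fun hs y⟩

theorem aux_range_free {A : Type} [AddCommGroup A] [Module.Free ℤ A] [Module.Finite ℤ A] (S : AddSubgroup A) :
    Module.Free ℤ S := by
  obtain ⟨n, b⟩ := Submodule.basisOfPid (Module.Free.chooseBasis ℤ A)
    (AddSubgroup.toIntSubmodule S)
  exact Module.Free.of_basis b

theorem aux_shift {P : ℤ → Type} (h : ∀ p, P (p + 1)) :
    ∃ φ : ∀ q, P q, ∀ p, φ (p + 1) = h p := by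
  refine ⟨fun q => cast (congrArg P (sub_add_cancel q 1)) (h (q - 1)), fun p => ?_⟩
  have key : ∀ (r : ℤ) (e : r = p) (e' : P (r + 1) = P (p + 1)), cast e' (h r) = h p := by
    rintro r rfl e'
    rfl
  exact key _ (add_sub_cancel_right p 1) _

/-- One-degree splitting data. -/
theorem aux_degree {A B C : Type} [AddCommGroup A] [AddCommGroup B] [AddCommGroup C]
    (d : B →+ C) (d' : A →+ B) (hdd : ∀ x, d (d' x) = 0)
    (s : d.range →+ B) (hs : ∀ y, d (s y) = y)
    (hH : Module.Free ℤ (d.ker ⧸ AddSubgroup.comap d.ker.subtype d'.range)) :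
    ∃ (f : B →+ (d.ker ⧸ AddSubgroup.comap d.ker.subtype d'.range))
      (g : (d.ker ⧸ AddSubgroup.comap d.ker.subtype d'.range) →+ B)
      (e : B →+ d'.range),
      (∀ x, f (d' x) = 0) ∧ (∀ y, d (g y) = 0) ∧ (∀ y, f (g y) = y) ∧
      (∀ x, x - g (f x) = s (d.rangeRestrict x) + e x) ∧
      (∀ y, e (g y) = 0) ∧ (∀ z, f (s z) = 0) ∧ (∀ z, e (s z) = 0) ∧
      (∀ x, e (d' x) = d'.rangeRestrict x) := by
  obtain ⟨t, ht⟩ := aux_section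
    (QuotientAddGroup.mk' (AddSubgroup.comap d.ker.subtype d'.range))
    (QuotientAddGroup.mk'_surjective _)
  let k : B →+ d.ker := (AddMonoidHom.id B - s.comp d.rangeRestrict).codRestrict d.ker (by
    intro x
    simp [AddMonoidHom.mem_ker, hs])
  have hk : ∀ x, (k x : B) = x - s (d.rangeRestrict x) := fun x => rfl
  have hkk : ∀ x : d.ker, k x = x := by
    intro x
    apply Subtype.ext
    rw [hk]
    have : d.rangeRestrict (x : B) = 0 := Subtype.ext x.2
    rw [this]; simp
  have hks : ∀ z, k (s z) = 0 := by
    intro z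
    apply Subtype.ext
    rw [hk]
    have : d.rangeRestrict (s z) = z := Subtype.ext (hs z)
    rw [this]; simp
  let π := QuotientAddGroup.mk' (AddSubgroup.comap d.ker.subtype d'.range)
  have ht' : ∀ y, π (t y) = y := ht
  have hπd : ∀ x, π (k (d' x)) = 0 := by
    intro x
    have h1 := hkk ⟨d' x, hdd x⟩
    simp only at h1
    rw [h1]
    exact (QuotientAddGroup.eq_zero_iff _).2 ⟨x, rfl⟩
  let e : B →+ d'.range :=
    (d.ker.subtype.comp (k - t.comp (π.comp k))).codRestrict d'.range (by
      intro x
      have : π (k x - t (π (k x))) = 0 := by rw [map_sub, ht', sub_self]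
      exact (QuotientAddGroup.eq_zero_iff (k x - t (π (k x)))).1 this)
  have he : ∀ x, (e x : B) = (k x : B) - t (π (k x)) := fun x => rfl
  refine ⟨π.comp k, d.ker.subtype.comp t, e, hπd, fun y => (t y).2, ?_, ?_, ?_, ?_, ?_, ?_⟩
  · intro y
    change π (k (t y)) = y
    rw [hkk, ht']
  · intro x
    rw [he, hk]
    change x - (t (π (k x)) : B) = _
    abel
  · intro y
    apply Subtype.ext
    rw [he]
    change ((k (t y) : d.ker) : B) - t (π (k (t y))) = 0
    rw [hkk, ht', sub_self]
  · intro z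
    change π (k (s z)) = 0
    rw [hks, map_zero]
  · intro z
    apply Subtype.ext
    rw [he, hks, map_zero, map_zero]
    simp
  · intro x
    apply Subtype.ext
    rw [he, hπd, map_zero]
    have h1 := hkk ⟨d' x, hdd x⟩
    simp only at h1
    rw [h1]
    simp

/-- A bounded chain complex `C` of finitely generated free abelian groups
(differentials `d q : X (q+1) → X q`, `d ∘ d = 0`, `X q = 0` for `q < 0` or `q > n`)
whose homology groups `H_{q+1} = ker (d q) / im (d (q+1))` are all free abelian admits a
contraction `(f, g, φ)` onto its homology `H`, viewed as a chain complex with zero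
differential: `f : C → H` and `g : H → C` are chain maps, `f ∘ g = id`,
`id - g ∘ f = φ∂ + ∂φ`, `φ ∘ g = 0`, `f ∘ φ = 0` and `φ ∘ φ = 0`.
(Here the map of the contraction family at degree `q + 1` is indexed by `q : ℤ`.) -/
theorem contraction_to_homology_of_free_homology
    (X : ℤ → Type) [∀ q, AddCommGroup (X q)]
    (hfree : ∀ q, Module.Free ℤ (X q)) (hfin : ∀ q, Module.Finite ℤ (X q))
    (n : ℤ) (hbound : ∀ q : ℤ, (q < 0 ∨ n < q) → ∀ x : X q, x = 0)
    (d : ∀ q : ℤ, X (q + 1) →+ X q)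
    (hdd : ∀ (q : ℤ) (x : X (q + 1 + 1)), d q (d (q + 1) x) = 0)
    (hHfree : ∀ q : ℤ, Module.Free ℤ
      ((AddMonoidHom.ker (d q)) ⧸
        (AddSubgroup.comap (AddMonoidHom.ker (d q)).subtype
          (AddMonoidHom.range (d (q + 1)))))) :
    ∃ (f : ∀ q : ℤ, X (q + 1) →+
        ((AddMonoidHom.ker (d q)) ⧸
          (AddSubgroup.comap (AddMonoidHom.ker (d q)).subtype
            (AddMonoidHom.range (d (q + 1))))))
      (g : ∀ q : ℤ,
        ((AddMonoidHom.ker (d q)) ⧸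
          (AddSubgroup.comap (AddMonoidHom.ker (d q)).subtype
            (AddMonoidHom.range (d (q + 1))))) →+ X (q + 1))
      (φ : ∀ q : ℤ, X q →+ X (q + 1)),
      -- `f` is a chain map into the complex with zero differential
      (∀ (q : ℤ) (x : X (q + 1 + 1)), f q (d (q + 1) x) = 0) ∧
      -- `g` is a chain map from the complex with zero differential
      (∀ (q : ℤ) y, d q (g q y) = 0) ∧
      -- `f ∘ g = id`
      (∀ (q : ℤ) y, f q (g q y) = y) ∧
      -- `id - g ∘ f = φ∂ + ∂φ`
      (∀ (q : ℤ) (x : X (q + 1)),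
        x - g q (f q x) = φ q (d q x) + d (q + 1) (φ (q + 1) x)) ∧
      -- `φ ∘ g = 0`
      (∀ (q : ℤ) y, φ (q + 1) (g q y) = 0) ∧
      -- `f ∘ φ = 0`
      (∀ (q : ℤ) (x : X q), f q (φ q x) = 0) ∧
      -- `φ ∘ φ = 0`
      (∀ (q : ℤ) (x : X q), φ (q + 1) (φ q x) = 0) := by
  have hs : ∀ q, ∃ s : (d q).range →+ X (q + 1), ∀ y, (d q).rangeRestrict (s y) = y := by
    intro q
    have := hfree q
    have := hfin q
    have := aux_range_free (d q).range
    exact aux_section _ (d q).rangeRestrict_surjective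
  choose s hs using hs
  have hs' : ∀ q y, d q (s q y) = y := fun q y => congrArg Subtype.val (hs q y)
  choose f g e h1 h2 h3 h4 h5 h6 h7 h8 using fun q =>
    aux_degree (d q) (d (q + 1)) (hdd q) (s q) (hs' q) (hHfree q)
  obtain ⟨φ, hφ⟩ := aux_shift (P := fun q => X q →+ X (q + 1))
    (fun p => (s (p + 1)).comp (e p))
  have hφ' : ∀ p x, φ (p + 1) x = s (p + 1) (e p x) := fun p x => by rw [hφ]; rfl
  refine ⟨f, g, φ, h1, h2, h3, ?_, ?_, ?_, ?_⟩
  · intro q x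
    rw [h4, hφ', hs']
    congr 1
    obtain ⟨p, rfl⟩ : ∃ p, q = p + 1 := ⟨q - 1, by ring⟩
    rw [hφ', h8]
  · intro q y
    rw [hφ', h5, map_zero]
  · intro q x
    obtain ⟨p, rfl⟩ : ∃ p, q = p + 1 := ⟨q - 1, by ring⟩
    rw [hφ', h6]
  · intro q x
    obtain ⟨p, rfl⟩ : ∃ p, q = p + 1 := ⟨q - 1, by ring⟩
    rw [hφ', hφ', h7, map_zero]
end
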